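/- Weighted bound on the marginals of the conditioned tensorized data (Corollary 12.6). Let d ≥ 2, ℓ > 0, β > 0, μ ∈ ℝ, and let f_0 be a probability density on ℝ^d × ℝ^d satisfying f_0(x,v) e^{μ} e^{(1/2)β|v|²} ≤ 1 for all (x,v). Then for any μ' < μ, in the Boltzmann–Grad scaling N ε^{d−1} = ℓ^{−1}, for all sufficiently large N: sup_{1≤s≤N} sup (ess sup)_{Z_s ∈ D_s} f_N^{(s)}(0,Z_s) e^{β E_s(Z_s)} e^{μ' s} ≤ 1, where E_s(Z_s) = (1/2)∑_{i=1}^s |v_i|². -/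

import Mathlib

noncomputable section
open MeasureTheory
open scoped BigOperators

/-- Euclidean space `ℝ^d`. -/
abbrev Rd (d : ℕ) := EuclideanSpace ℝ (Fin d)

/-- The `s`-particle hard-sphere phase space `D_s`: all pairwise distances exceed `ε`. -/
def Dset (d s : ℕ) (ε : ℝ) : Set (Fin s → Rd d × Rd d) :=
  {Z | ∀ i j : Fin s, i < j → ε < dist (Z i).1 (Z j).1}

/-- The partition function `𝒵_s = ∫ 1_{Z_s ∈ D_s} ∏ f₀(z_i) dZ_s`. -/
def partitionFunction (d s : ℕ) (ε : ℝ) (f₀ : Rd d × Rd d → ℝ) : ℝ :=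
  ∫ Z in Dset d s ε, ∏ i, f₀ (Z i)

/-- The volume of the unit ball in `ℝ^d`. -/
def unitBallVol (d : ℕ) : ℝ := (volume (Metric.ball (0 : Rd d) 1)).toReal

/-- The conditioned tensorized `N`-particle density
`f_N(0,Z_N) = 𝒵_N⁻¹ 1_{Z_N ∈ D_N} ∏ f₀(z_i)`. -/
def conditionedData (d N : ℕ) (ε : ℝ) (f₀ : Rd d × Rd d → ℝ)
    (Z : Fin N → Rd d × Rd d) : ℝ :=
  (partitionFunction d N ε f₀)⁻¹ *
    Set.indicator (Dset d N ε) (fun W => ∏ i, f₀ (W i)) Z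

/-- The `s`-particle marginal of an `N`-particle function. -/
def marginal (d N s : ℕ) (hsN : s ≤ N) (F : (Fin N → Rd d × Rd d) → ℝ)
    (Z : Fin s → Rd d × Rd d) : ℝ :=
  ∫ W : Fin (N - s) → Rd d × Rd d,
    F (Fin.append Z W ∘ Fin.cast (Nat.add_sub_cancel' hsN).symm)

/-- The kinetic energy `E_s(Z_s) = (1/2) ∑ |v_i|²`. -/
def energy {d s : ℕ} (Z : Fin s → Rd d × Rd d) : ℝ := (1 / 2) * ∑ i, ‖(Z i).2‖ ^ 2

theorem measurableSet_Dset (d s : ℕ) (ε : ℝ) : MeasurableSet (Dset d s ε) := by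
  have h : Dset d s ε = ⋂ i : Fin s, ⋂ j : Fin s, ⋂ _ : i < j,
      {Z | ε < dist (Z i).1 (Z j).1} := by
    ext Z; simp [Dset]
  rw [h]
  refine MeasurableSet.iInter fun i => MeasurableSet.iInter fun j => MeasurableSet.iInter fun _ =>
    measurableSet_lt measurable_const ?_
  fun_prop

theorem cons_mem_Dset_iff {d n : ℕ} {ε : ℝ} {z : Rd d × Rd d} {W : Fin n → Rd d × Rd d} :
    (Fin.cons z W : Fin (n + 1) → Rd d × Rd d) ∈ Dset d (n + 1) ε ↔
      (∀ i, ε < dist z.1 (W i).1) ∧ W ∈ Dset d n ε := by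
  simp [Dset, Fin.forall_fin_succ]

/-- The unnormalized `N`-particle density restricted to the hard-sphere phase space is
integrable. -/
theorem integrable_indicator_Dset_prod {d : ℕ} (n : ℕ) (ε : ℝ) {f₀ : Rd d × Rd d → ℝ}
    (hint : Integrable f₀) :
    Integrable ((Dset d n ε).indicator fun W => ∏ i, f₀ (W i)) :=
  (Integrable.fintype_prod (f := fun _ : Fin n => f₀) fun _ => hint).indicator
    (measurableSet_Dset d n ε)

theorem partitionFunction_eq_integral_indicator (d n : ℕ) (ε : ℝ) (f₀ : Rd d × Rd d → ℝ) :
    partitionFunction d n ε f₀ = ∫ W, (Dset d n ε).indicator (fun W => ∏ i, f₀ (W i)) W :=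
  (integral_indicator (measurableSet_Dset d n ε)).symm

theorem partitionFunction_nonneg (d n : ℕ) (ε : ℝ) {f₀ : Rd d × Rd d → ℝ}
    (hnn : ∀ z, 0 ≤ f₀ z) : 0 ≤ partitionFunction d n ε f₀ :=
  integral_nonneg fun _ => Finset.prod_nonneg fun _ _ => hnn _

theorem partitionFunction_zero (d : ℕ) (ε : ℝ) (f₀ : Rd d × Rd d → ℝ) :
    partitionFunction d 0 ε f₀ = 1 := by
  have h : Dset d 0 ε = Set.univ := by ext Z; simp [Dset]
  simp [partitionFunction, h, integral_const, Measure.real, volume_pi]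

theorem partitionFunction_succ {d n : ℕ} (ε : ℝ) {f₀ : Rd d × Rd d → ℝ} (hint : Integrable f₀) :
    Integrable (fun W : Fin n → Rd d × Rd d => ∫ z, (Dset d (n + 1) ε).indicator
      (fun Z => ∏ i, f₀ (Z i)) (Fin.cons z W : Fin (n + 1) → Rd d × Rd d)) ∧
    partitionFunction d (n + 1) ε f₀ = ∫ W : Fin n → Rd d × Rd d, ∫ z,
      (Dset d (n + 1) ε).indicator (fun Z => ∏ i, f₀ (Z i))
        (Fin.cons z W : Fin (n + 1) → Rd d × Rd d) := by
  set g := (Dset d (n + 1) ε).indicator fun Z => ∏ i, f₀ (Z i)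
  have hmp := (volume_preserving_piFinSuccAbove (fun _ : Fin (n + 1) => Rd d × Rd d) 0).symm
  have hemb := (MeasurableEquiv.piFinSuccAbove
    (fun _ : Fin (n + 1) => Rd d × Rd d) 0).symm.measurableEmbedding
  have hcons : (g ∘ (MeasurableEquiv.piFinSuccAbove
      (fun _ : Fin (n + 1) => Rd d × Rd d) 0).symm) =
      fun p => g (Fin.cons p.1 p.2 : Fin (n + 1) → Rd d × Rd d) := by
    funext p
    simp [MeasurableEquiv.piFinSuccAbove_symm_apply, Fin.insertNthEquiv]
  have hgi : Integrable (fun p : (Rd d × Rd d) × (Fin n → Rd d × Rd d) =>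
      g (Fin.cons p.1 p.2 : Fin (n + 1) → Rd d × Rd d)) (volume.prod volume) := by
    rw [← hcons]
    exact (hmp.integrable_comp_emb hemb).2 (integrable_indicator_Dset_prod (n + 1) ε hint)
  have : SigmaFinite (volume : Measure (Rd d × Rd d)) :=
    inferInstanceAs (SigmaFinite ((volume : Measure (Rd d)).prod (volume : Measure (Rd d))))
  have : SigmaFinite (volume : Measure (Fin n → Rd d × Rd d)) :=
    Measure.pi.sigmaFinite fun _ => volume
  refine ⟨hgi.integral_prod_right, ?_⟩
  rw [partitionFunction_eq_integral_indicator, ← hmp.integral_comp hemb]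
  exact (congrArg (fun F => ∫ p, F p) hcons).trans (integral_prod_symm _ hgi)

/-- Inserting one more particle costs at most a factor `1 - n δ`, where `δ` bounds the mass of `f₀`
over any ball of radius `ε`. -/
theorem mul_partitionFunction_le_succ {d : ℕ} (n : ℕ) {ε δ : ℝ} {f₀ : Rd d × Rd d → ℝ}
    (hnn : ∀ z, 0 ≤ f₀ z) (hint : Integrable f₀) (hmass : ∫ z, f₀ z = 1)
    (hδ : ∀ x : Rd d, ∫ z in Metric.closedBall x ε ×ˢ Set.univ, f₀ z ≤ δ) :
    (1 - n * δ) * partitionFunction d n ε f₀ ≤ partitionFunction d (n + 1) ε f₀ := by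
  obtain ⟨hi, he⟩ := partitionFunction_succ (n := n) ε hint
  rw [he, partitionFunction_eq_integral_indicator, ← integral_const_mul]
  refine integral_mono ((integrable_indicator_Dset_prod n ε hint).const_mul _) hi fun W => ?_
  by_cases hW : W ∈ Dset d n ε
  swap
  · simp [Set.indicator, cons_mem_Dset_iff, hW]
  have hBm (i : Fin n) :
      MeasurableSet (Metric.closedBall (W i).1 ε ×ˢ (Set.univ : Set (Rd d))) :=
    Metric.isClosed_closedBall.measurableSet.prod MeasurableSet.univ
  have hBi (i : Fin n) := hint.indicator (hBm i)
  have hint_lower : Integrable fun z => f₀ z -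
      ∑ i : Fin n, (Metric.closedBall (W i).1 ε ×ˢ Set.univ).indicator f₀ z :=
    hint.sub (integrable_finsetSum _ fun i _ => hBi i)
  have hlower : 1 - n * δ ≤ ∫ z, (f₀ z -
      ∑ i : Fin n, (Metric.closedBall (W i).1 ε ×ˢ Set.univ).indicator f₀ z) := by
    rw [integral_sub hint (integrable_finsetSum _ fun i _ => hBi i), hmass,
      integral_finsetSum _ fun i _ => hBi i]
    refine sub_le_sub_left ?_ _
    calc _ ≤ ∑ _i : Fin n, δ := Finset.sum_le_sum fun i _ => by
            rw [integral_indicator (hBm i)]; exact hδ _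
      _ = n * δ := by simp
  have hA : MeasurableSet {z : Rd d × Rd d | ∀ i, ε < dist z.1 (W i).1} := by
    rw [Set.ofPred_forall]
    refine MeasurableSet.iInter fun i => measurableSet_lt measurable_const ?_
    fun_prop
  have hcons : (fun z => (Dset d (n + 1) ε).indicator (fun Z => ∏ i, f₀ (Z i))
      (Fin.cons z W : Fin (n + 1) → Rd d × Rd d)) = fun z =>
      {z : Rd d × Rd d | ∀ i, ε < dist z.1 (W i).1}.indicator f₀ z * ∏ i, f₀ (W i) := by
    funext z
    by_cases hz : ∀ i, ε < dist z.1 (W i).1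
    · simp [Set.indicator, cons_mem_Dset_iff, hW, hz, Fin.prod_univ_succ]
    · simp [Set.indicator, cons_mem_Dset_iff, hz]
  simp only [hcons, integral_mul_const, Set.indicator_of_mem hW]
  refine mul_le_mul_of_nonneg_right (hlower.trans ?_) (Finset.prod_nonneg fun _ _ => hnn _)
  refine integral_mono hint_lower (hint.indicator hA) fun z => ?_
  by_cases hz : ∀ i, ε < dist z.1 (W i).1
  · simp only [Set.indicator_of_mem (s := {z : Rd d × Rd d | ∀ i, ε < dist z.1 (W i).1}) hz]
    exact sub_le_self _ (Finset.sum_nonneg fun i _ => Set.indicator_nonneg (fun _ _ => hnn _) _)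
  · simp only [Set.indicator_of_notMem (s := {z : Rd d × Rd d | ∀ i, ε < dist z.1 (W i).1}) hz]
    push Not at hz
    obtain ⟨i, hi⟩ := hz
    have hmem : z ∈ Metric.closedBall (W i).1 ε ×ˢ (Set.univ : Set (Rd d)) := by simpa using hi
    have := Finset.single_le_sum (f := fun i : Fin n =>
      (Metric.closedBall (W i).1 ε ×ˢ (Set.univ : Set (Rd d))).indicator f₀ z)
      (fun i _ => Set.indicator_nonneg (fun _ _ => hnn _) _) (Finset.mem_univ i)
    rw [Set.indicator_of_mem hmem] at this
    linarith

/-- A density with a Gaussian velocity bound has mass `O(ε ^ d)` over balls of radius `ε` in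
position space. -/
theorem exists_setIntegral_closedBall_prod_le {d : ℕ} {β μ : ℝ} (hβ : 0 < β)
    {f₀ : Rd d × Rd d → ℝ} (hint : Integrable f₀)
    (hweight : ∀ z : Rd d × Rd d,
      f₀ z * Real.exp μ * Real.exp ((1 / 2) * β * ‖z.2‖ ^ 2) ≤ 1) :
    ∃ C : ℝ, 0 < C ∧ ∀ ε : ℝ, 0 < ε → ∀ x : Rd d,
      ∫ z in Metric.closedBall x ε ×ˢ Set.univ, f₀ z ≤ C * ε ^ d := by
  have hG : Integrable fun v : Rd d => Real.exp (-(1 / 2 * β) * ‖v‖ ^ 2) := by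
    have h := (GaussianFourier.integrable_cexp_neg_mul_sq_norm_add (V := Rd d)
      (b := ((1 / 2 * β : ℝ) : ℂ)) (by rw [Complex.ofReal_re]; positivity) 0 0).norm
    refine h.congr (Filter.Eventually.of_forall fun v => ?_)
    simp only [Complex.norm_exp]
    congr 1
    norm_cast
    simp
  set I := ∫ v : Rd d, Real.exp (-(1 / 2 * β) * ‖v‖ ^ 2)
  have hI : 0 ≤ I := integral_nonneg fun _ => (Real.exp_pos _).le
  set V := volume.real (Metric.ball (0 : Rd d) 1)
  have hV : 0 ≤ V := measureReal_nonneg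
  refine ⟨V * Real.exp (-μ) * I + 1, by positivity, fun ε hε x => ?_⟩
  have hprod : IntegrableOn (fun z : Rd d × Rd d =>
      Real.exp (-μ) * Real.exp (-(1 / 2 * β) * ‖z.2‖ ^ 2)) (Metric.closedBall x ε ×ˢ Set.univ) := by
    have h1 : IntegrableOn (fun _ : Rd d => Real.exp (-μ)) (Metric.closedBall x ε) :=
      integrableOn_const measure_closedBall_lt_top.ne
    rw [IntegrableOn, Measure.volume_eq_prod, ← Measure.prod_restrict, Measure.restrict_univ]
    exact h1.mul_prod hG
  calc ∫ z in Metric.closedBall x ε ×ˢ Set.univ, f₀ z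
      ≤ ∫ z in Metric.closedBall x ε ×ˢ Set.univ,
          Real.exp (-μ) * Real.exp (-(1 / 2 * β) * ‖z.2‖ ^ 2) := by
        refine integral_mono hint.integrableOn hprod fun z => ?_
        have h := hweight z
        rw [mul_assoc, ← Real.exp_add, ← le_div_iff₀ (Real.exp_pos _), one_div,
          ← Real.exp_neg] at h
        refine h.trans_eq ?_
        rw [← Real.exp_add]
        ring_nf
    _ = (∫ _ in Metric.closedBall x ε, Real.exp (-μ)) * I := by
        have := setIntegral_prod_mul (μ := (volume : Measure (Rd d)))
          (ν := (volume : Measure (Rd d))) (fun _ => Real.exp (-μ))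
          (fun v => Real.exp (-(1 / 2 * β) * ‖v‖ ^ 2)) (Metric.closedBall x ε) Set.univ
        rw [Measure.restrict_univ] at this
        exact this
    _ = V * Real.exp (-μ) * I * ε ^ d := by
        rw [setIntegral_const, Measure.addHaar_real_closedBall _ _ hε.le,
          finrank_euclideanSpace_fin, smul_eq_mul]
        ring
    _ ≤ (V * Real.exp (-μ) * I + 1) * ε ^ d := by
        gcongr
        linarith

/-- If each insertion costs at most a factor `q`, then inserting `k` particles costs at most
`q ^ k`. -/
theorem pow_mul_partitionFunction_le {d N : ℕ} {ε q : ℝ} {f₀ : Rd d × Rd d → ℝ} (hq : 0 ≤ q)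
    (hstep : ∀ n < N, q * partitionFunction d n ε f₀ ≤ partitionFunction d (n + 1) ε f₀)
    (n k : ℕ) (hnk : n + k ≤ N) :
    q ^ k * partitionFunction d n ε f₀ ≤ partitionFunction d (n + k) ε f₀ := by
  induction k with
  | zero => simp
  | succ k ih =>
    calc q ^ (k + 1) * partitionFunction d n ε f₀
        = q * (q ^ k * partitionFunction d n ε f₀) := by ring
      _ ≤ q * partitionFunction d (n + k) ε f₀ := by gcongr; exact ih (by omega)
      _ ≤ _ := hstep (n + k) (by omega)

/-- Dropping the exclusion constraint between the first `s` particles and the rest. -/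
theorem marginal_conditionedData_le {d N s : ℕ} (hsN : s ≤ N) (ε : ℝ) {f₀ : Rd d × Rd d → ℝ}
    (hnn : ∀ z, 0 ≤ f₀ z) (hint : Integrable f₀) (Z : Fin s → Rd d × Rd d) :
    marginal d N s hsN (conditionedData d N ε f₀) Z ≤
      (partitionFunction d N ε f₀)⁻¹ * ((∏ i, f₀ (Z i)) * partitionFunction d (N - s) ε f₀) := by
  have hZ := inv_nonneg.2 (partitionFunction_nonneg d N ε hnn)
  rw [partitionFunction_eq_integral_indicator d (N - s), ← integral_const_mul,
    ← integral_const_mul]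
  refine integral_mono_of_nonneg (Filter.Eventually.of_forall fun W => ?_)
    (((integrable_indicator_Dset_prod (N - s) ε hint).const_mul _).const_mul _)
    (Filter.Eventually.of_forall fun W => ?_)
  · exact mul_nonneg hZ (Set.indicator_nonneg (fun _ _ => Finset.prod_nonneg fun _ _ => hnn _) _)
  refine mul_le_mul_of_nonneg_left ?_ hZ
  set Y := Fin.append Z W ∘ Fin.cast (Nat.add_sub_cancel' hsN).symm with hY
  have hprod : ∏ i, f₀ (Y i) = (∏ i, f₀ (Z i)) * ∏ i, f₀ (W i) := by
    rw [Fintype.prod_equiv (finCongr (Nat.add_sub_cancel' hsN).symm) (fun i => f₀ (Y i))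
      (fun i => f₀ (Fin.append Z W i)) fun i => rfl, Fin.prod_univ_add]
    simp
  by_cases hmem : Y ∈ Dset d N ε
  · have hW : W ∈ Dset d (N - s) ε := fun i j hij => by
      have := hmem (Fin.cast (Nat.add_sub_cancel' hsN) (Fin.natAdd s i))
        (Fin.cast (Nat.add_sub_cancel' hsN) (Fin.natAdd s j)) (Nat.add_lt_add_left hij s)
      simpa [hY] using this
    rw [Set.indicator_of_mem hmem, Set.indicator_of_mem hW, hprod]
  · rw [Set.indicator_of_notMem hmem]
    exact mul_nonneg (Finset.prod_nonneg fun _ _ => hnn _)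
      (Set.indicator_nonneg (fun _ _ => Finset.prod_nonneg fun _ _ => hnn _) _)

/-- The tensorized form of the Gaussian weight bound. -/
theorem prod_mul_exp_energy_le {d s : ℕ} {β μ : ℝ} {f₀ : Rd d × Rd d → ℝ} (hnn : ∀ z, 0 ≤ f₀ z)
    (hweight : ∀ z : Rd d × Rd d,
      f₀ z * Real.exp μ * Real.exp ((1 / 2) * β * ‖z.2‖ ^ 2) ≤ 1)
    (Z : Fin s → Rd d × Rd d) :
    (∏ i, f₀ (Z i)) * Real.exp (β * energy Z) * Real.exp μ ^ s ≤ 1 := by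
  have hE : Real.exp (β * energy Z) = ∏ i, Real.exp ((1 / 2) * β * ‖(Z i).2‖ ^ 2) := by
    rw [← Real.exp_sum, energy, ← Finset.mul_sum]
    ring_nf
  have hs : Real.exp μ ^ s = ∏ _i : Fin s, Real.exp μ := by simp
  rw [hE, hs, ← Finset.prod_mul_distrib, ← Finset.prod_mul_distrib]
  refine Finset.prod_le_one (fun i _ => ?_) fun i _ => ?_
  · have := hnn (Z i)
    positivity
  · exact (mul_right_comm _ _ _).trans_le (hweight (Z i))

/-- **Weighted bound on the marginals of the conditioned tensorized data
(Corollary 12.6).** If `f₀ e^μ e^{(1/2)β|v|²} ≤ 1`, then for any `μ' < μ`, in the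
Boltzmann–Grad scaling, for all sufficiently large `N`:
`f_N^{(s)}(0,Z_s) e^{β E_s(Z_s)} e^{μ' s} ≤ 1` for all `1 ≤ s ≤ N` and a.e. `Z_s ∈ D_s`. -/
theorem conditioned_data_weighted_bound
    (d : ℕ) (hd : 2 ≤ d) (ℓ β μ μ' : ℝ) (hℓ : 0 < ℓ) (hβ : 0 < β) (hμ' : μ' < μ)
    (f₀ : Rd d × Rd d → ℝ) (hmeas : Measurable f₀) (hnn : ∀ z, 0 ≤ f₀ z)
    (hint : Integrable f₀) (hmass : ∫ z, f₀ z = 1)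
    (hweight : ∀ z : Rd d × Rd d,
      f₀ z * Real.exp μ * Real.exp ((1 / 2) * β * ‖z.2‖ ^ 2) ≤ 1) :
    ∃ N₀ : ℕ, ∀ N : ℕ, N₀ ≤ N → ∀ ε : ℝ, 0 < ε → (N : ℝ) * ε ^ (d - 1) = ℓ⁻¹ →
      ∀ s : ℕ, 1 ≤ s → ∀ hsN : s ≤ N,
        ∀ᵐ Z ∂(volume.restrict (Dset d s ε)),
          marginal d N s hsN (conditionedData d N ε f₀) Z *
              Real.exp (β * energy Z) * Real.exp (μ' * s) ≤ 1 := by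
  obtain ⟨C, hC, hball⟩ := exists_setIntegral_closedBall_prod_le hβ hint hweight
  set q := Real.exp (μ' - μ) with hq_def
  have hq : 0 < q := Real.exp_pos _
  have hq1 : q < 1 := Real.exp_lt_one_iff.2 (by linarith)
  set η := (1 - q) * ℓ / C with hη_def
  have hη : 0 < η := div_pos (mul_pos (by linarith) hℓ) hC
  obtain ⟨N₀, hN₀⟩ := exists_nat_gt (ℓ⁻¹ / η ^ (d - 1))
  refine ⟨N₀, fun N hN ε hε hscale s _ hsN => Filter.Eventually.of_forall fun Z => ?_⟩
  have hεη : ε ≤ η := by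
    by_contra! hlt
    have h1 : ℓ⁻¹ < N * η ^ (d - 1) :=
      (div_lt_iff₀ (by positivity)).1 (hN₀.trans_le (by exact_mod_cast hN))
    have h2 : (N : ℝ) * η ^ (d - 1) ≤ N * ε ^ (d - 1) := by gcongr
    linarith
  have hNδ : (N : ℝ) * (C * ε ^ d) ≤ 1 - q := by
    have hpow : ε ^ d = ε ^ (d - 1) * ε := by rw [← pow_succ, Nat.sub_add_cancel (by omega)]
    calc (N : ℝ) * (C * ε ^ d) = C * (N * ε ^ (d - 1)) * ε := by rw [hpow]; ring
      _ = C * ℓ⁻¹ * ε := by rw [hscale]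
      _ ≤ C * ℓ⁻¹ * η := by gcongr
      _ = 1 - q := by rw [hη_def]; field_simp
  have hstep : ∀ n < N,
      q * partitionFunction d n ε f₀ ≤ partitionFunction d (n + 1) ε f₀ := fun n hn => by
    refine le_trans (mul_le_mul_of_nonneg_right ?_ (partitionFunction_nonneg d n ε hnn))
      (mul_partitionFunction_le_succ n hnn hint hmass (hball ε hε))
    have : (n : ℝ) * (C * ε ^ d) ≤ N * (C * ε ^ d) := by gcongr
    linarith
  have hpos : 0 < partitionFunction d N ε f₀ := by
    have := pow_mul_partitionFunction_le hq.le hstep 0 N (by omega)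
    rw [partitionFunction_zero, mul_one, Nat.zero_add] at this
    exact (pow_pos hq N).trans_le this
  have hratio : q ^ s * partitionFunction d (N - s) ε f₀ ≤ partitionFunction d N ε f₀ := by
    have := pow_mul_partitionFunction_le hq.le hstep (N - s) s (by omega)
    rwa [Nat.sub_add_cancel hsN] at this
  have hexp : Real.exp (μ' * s) = q ^ s * Real.exp μ ^ s := by
    rw [← mul_pow, hq_def, ← Real.exp_add, sub_add_cancel, mul_comm, Real.exp_nat_mul]
  have hPnn := partitionFunction_nonneg d (N - s) ε hnn
  calc marginal d N s hsN (conditionedData d N ε f₀) Z *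
        Real.exp (β * energy Z) * Real.exp (μ' * s)
      ≤ (partitionFunction d N ε f₀)⁻¹ *
          ((∏ i, f₀ (Z i)) * partitionFunction d (N - s) ε f₀) *
          Real.exp (β * energy Z) * Real.exp (μ' * s) := by
        gcongr
        exact marginal_conditionedData_le hsN ε hnn hint Z
    _ = (partitionFunction d N ε f₀)⁻¹ * (q ^ s * partitionFunction d (N - s) ε f₀) *
          ((∏ i, f₀ (Z i)) * Real.exp (β * energy Z) * Real.exp μ ^ s) := by
        rw [hexp]; ring
    _ ≤ (partitionFunction d N ε f₀)⁻¹ * (q ^ s * partitionFunction d (N - s) ε f₀) :=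
        mul_le_of_le_one_right (by positivity) (prod_mul_exp_energy_le hnn hweight Z)
    _ ≤ 1 := (inv_mul_le_one₀ hpos).2 hratio
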